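/- arXiv:1701.04223 — 2 statements merged into one kernel-verified Lean document; each statement's English description precedes it below -/
import Mathlib

section
/- Let X₁ → X₂ ⊕ Y₂ → X₃ → X₁⟦1⟧ be a distinguished triangle in C whose first map has components f₁ : X₁ → X₂ and g₁ : X₁ → Y₂, and whose second map has components f₂ : X₂ → X₃ and g₂ : Y₂ → X₃. If g₂ = 0 or g₁ is a split epimorphism, then there exist an object X₁' and morphisms f₁₁ : X₁' → X₂ and f₃₁ : X₃ → X₁'⟦1⟧ such that (X₁', X₂, X₃; f₁₁, f₂, f₃₁) is a distinguished triangle and the given triangle is isomorphic (as a triangle) to the direct sum of (X₁', X₂, X₃; f₁₁, f₂, f₃₁) with the triangle (Y₂, Y₂, 0; 1_{Y₂}, 0, 0). -/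
open CategoryTheory CategoryTheory.Limits CategoryTheory.Pretriangulated ZeroObject

variable {C : Type*} [Category C] [Preadditive C] [HasZeroObject C] [HasBinaryBiproducts C]
  [HasShift C ℤ] [∀ n : ℤ, (shiftFunctor C n).Additive] [Pretriangulated C]

/-- The direct sum of two triangles: the triangle on the biproducts of the corresponding
objects, with the componentwise maps. -/
noncomputable def triangleSum (T T' : Triangle C) : Triangle C :=
  Triangle.mk (biprod.map T.mor₁ T'.mor₁) (biprod.map T.mor₂ T'.mor₂)
    (biprod.desc (T.mor₃ ≫ (biprod.inl : T.obj₁ ⟶ T.obj₁ ⊞ T'.obj₁)⟦(1:ℤ)⟧')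
      (T'.mor₃ ≫ (biprod.inr : T'.obj₁ ⟶ T.obj₁ ⊞ T'.obj₁)⟦(1:ℤ)⟧'))

/-- The mapping cone of a morphism of triangles `φ : T₁ ⟶ T₂`: the triangle with objects
`T₁.obj₂ ⊞ T₂.obj₁`, `T₁.obj₃ ⊞ T₂.obj₂`, `T₁.obj₁⟦1⟧ ⊞ T₂.obj₃` and maps given in matrix
form by `[[-f₂, 0], [φ₂, g₁]]`, `[[-f₃, 0], [φ₃, g₂]]`, `[[-f₁⟦1⟧, 0], [φ₁⟦1⟧, g₃]]`. -/
noncomputable def triangleCone {T₁ T₂ : Triangle C} (φ : T₁ ⟶ T₂) : Triangle C :=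
  Triangle.mk
    (biprod.desc (biprod.lift (-T₁.mor₂) φ.hom₂) (biprod.lift 0 T₂.mor₁))
    (biprod.desc (biprod.lift (-T₁.mor₃) φ.hom₃) (biprod.lift 0 T₂.mor₂))
    (biprod.desc ((biprod.lift (-T₁.mor₁) φ.hom₁ : T₁.obj₁ ⟶ T₁.obj₂ ⊞ T₂.obj₁)⟦(1:ℤ)⟧')
      (T₂.mor₃ ≫ (biprod.inr : T₂.obj₁ ⟶ T₁.obj₂ ⊞ T₂.obj₁)⟦(1:ℤ)⟧'))

/-- A triangle is contractible if its identity morphism is null-homotopic. -/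
def triangleContractible (T : Triangle C) : Prop :=
  ∃ (h₁ : T.obj₂ ⟶ T.obj₁) (h₂ : T.obj₃ ⟶ T.obj₂) (h₃ : T.obj₁⟦(1:ℤ)⟧ ⟶ T.obj₃),
    𝟙 T.obj₂ = h₁ ≫ T.mor₁ + T.mor₂ ≫ h₂ ∧
    𝟙 T.obj₃ = h₂ ≫ T.mor₂ + T.mor₃ ≫ h₃ ∧
    𝟙 (T.obj₁⟦(1:ℤ)⟧) = (T.mor₁ ≫ h₁)⟦(1:ℤ)⟧' + h₃ ≫ T.mor₃

/-- The projection of a direct sum of triangles onto its first summand. -/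
noncomputable def triangleSumFst (T T' : Triangle C) : triangleSum T T' ⟶ T where
  hom₁ := (biprod.fst : T.obj₁ ⊞ T'.obj₁ ⟶ _)
  hom₂ := (biprod.fst : T.obj₂ ⊞ T'.obj₂ ⟶ _)
  hom₃ := (biprod.fst : T.obj₃ ⊞ T'.obj₃ ⟶ _)
  comm₁ := biprod.map_fst _ _
  comm₂ := biprod.map_fst _ _
  comm₃ := by
    change biprod.desc (T.mor₃ ≫ (biprod.inl : T.obj₁ ⟶ T.obj₁ ⊞ T'.obj₁)⟦(1:ℤ)⟧')
      (T'.mor₃ ≫ (biprod.inr : T'.obj₁ ⟶ T.obj₁ ⊞ T'.obj₁)⟦(1:ℤ)⟧') ≫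
        (biprod.fst : T.obj₁ ⊞ T'.obj₁ ⟶ _)⟦(1:ℤ)⟧' =
      (biprod.fst : T.obj₃ ⊞ T'.obj₃ ⟶ _) ≫ T.mor₃
    apply biprod.hom_ext' <;> simp [← Functor.map_comp]

/-- The projection of a direct sum of triangles onto its second summand. -/
noncomputable def triangleSumSnd (T T' : Triangle C) : triangleSum T T' ⟶ T' where
  hom₁ := (biprod.snd : T.obj₁ ⊞ T'.obj₁ ⟶ _)
  hom₂ := (biprod.snd : T.obj₂ ⊞ T'.obj₂ ⟶ _)
  hom₃ := (biprod.snd : T.obj₃ ⊞ T'.obj₃ ⟶ _)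
  comm₁ := biprod.map_snd _ _
  comm₂ := biprod.map_snd _ _
  comm₃ := by
    change biprod.desc (T.mor₃ ≫ (biprod.inl : T.obj₁ ⟶ T.obj₁ ⊞ T'.obj₁)⟦(1:ℤ)⟧')
      (T'.mor₃ ≫ (biprod.inr : T'.obj₁ ⟶ T.obj₁ ⊞ T'.obj₁)⟦(1:ℤ)⟧') ≫
        (biprod.snd : T.obj₁ ⊞ T'.obj₁ ⟶ _)⟦(1:ℤ)⟧' =
      (biprod.snd : T.obj₃ ⊞ T'.obj₃ ⟶ _) ≫ T'.mor₃
    apply biprod.hom_ext' <;> simp [← Functor.map_comp]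

/-- A morphism from a biproduct to a product over `WalkingPair` whose components are the
projections is an isomorphism. -/
lemma isIso_of_comp_walkingPair_π {D : Type*} [Category D] [Preadditive D]
    [HasBinaryBiproducts D] {X : WalkingPair → D} [HasProduct X]
    (f : X .left ⊞ X .right ⟶ ∏ᶜ X) (h₁ : f ≫ Pi.π X .left = biprod.fst)
    (h₂ : f ≫ Pi.π X .right = biprod.snd) : IsIso f := by
  refine ⟨biprod.lift (Pi.π X .left) (Pi.π X .right), ?_, ?_⟩
  · apply biprod.hom_ext <;> simp [h₁, h₂]
  · apply Pi.hom_ext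
    rintro (_ | _) <;> simp [h₁, h₂]

/-- A direct sum of two distinguished triangles is distinguished. -/
lemma triangleSum_distinguished {T T' : Triangle C} (hT : T ∈ distTriang C)
    (hT' : T' ∈ distTriang C) : triangleSum T T' ∈ distTriang C := by
  have : HasFiniteProducts C := hasFiniteProducts_of_has_binary_and_terminal
  let F : WalkingPair → Triangle C := fun j => WalkingPair.casesOn j T T'
  have hF : productTriangle F ∈ distTriang C :=
    productTriangle_distinguished F (by rintro (_ | _); exacts [hT, hT'])
  let φ : triangleSum T T' ⟶ productTriangle F := productTriangle.lift F fun j =>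
    match j with
    | .left => triangleSumFst T T'
    | .right => triangleSumSnd T T'
  have : IsIso φ := Triangle.isIso_of_isIsos φ
    (isIso_of_comp_walkingPair_π (X := fun j => (F j).obj₁) φ.hom₁
      (Pi.lift_π _ _) (Pi.lift_π _ _))
    (isIso_of_comp_walkingPair_π (X := fun j => (F j).obj₂) φ.hom₂
      (Pi.lift_π _ _) (Pi.lift_π _ _))
    (isIso_of_comp_walkingPair_π (X := fun j => (F j).obj₃) φ.hom₃
      (Pi.lift_π _ _) (Pi.lift_π _ _))
  exact isomorphic_distinguished _ hF _ (asIso φ)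

/-- An isomorphism between the second morphisms of two distinguished triangles extends to an
isomorphism of triangles. -/
lemma nonempty_triangle_iso_of_iso₂₃ {T T' : Triangle C} (hT : T ∈ distTriang C)
    (hT' : T' ∈ distTriang C) (e₂ : T.obj₂ ≅ T'.obj₂) (e₃ : T.obj₃ ≅ T'.obj₃)
    (comm : T.mor₂ ≫ e₃.hom = e₂.hom ≫ T'.mor₂) : Nonempty (T ≅ T') := by
  obtain ⟨a, ha₁, ha₃⟩ :=
    complete_distinguished_triangle_morphism₁ T T' hT hT' e₂.hom e₃.hom comm
  let φ : T ⟶ T' := Triangle.homMk _ _ a e₂.hom e₃.hom ha₁ comm ha₃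
  have h₂ : IsIso φ.hom₂ := inferInstanceAs (IsIso e₂.hom)
  have h₃ : IsIso φ.hom₃ := inferInstanceAs (IsIso e₃.hom)
  have := Triangle.isIso_of_isIsos φ (isIso₁_of_isIso₂₃ φ hT hT' h₂ h₃) h₂ h₃
  exact ⟨asIso φ⟩


/-- If `X₁ → X₂ ⊞ Y₂ → X₃ → X₁⟦1⟧` is a distinguished triangle whose first map has
components `f₁, g₁` and second map has components `f₂, g₂`, and `g₂ = 0` or `g₁` is a split
epimorphism, then the triangle is isomorphic to the direct sum of a distinguished triangle
`(X₁', X₂, X₃; f₁₁, f₂, f₃₁)` and the triangle `(Y₂, Y₂, 0; 𝟙, 0, 0)`. -/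
theorem stmt3 {X₁ X₂ Y₂ X₃ : C} (f₁ : X₁ ⟶ X₂) (g₁ : X₁ ⟶ Y₂)
    (f₂ : X₂ ⟶ X₃) (g₂ : Y₂ ⟶ X₃) (f₃ : X₃ ⟶ X₁⟦(1:ℤ)⟧)
    (hT : Triangle.mk (biprod.lift f₁ g₁) (biprod.desc f₂ g₂) f₃ ∈ distTriang C)
    (h : g₂ = 0 ∨ ∃ s : Y₂ ⟶ X₁, s ≫ g₁ = 𝟙 Y₂) :
    ∃ (X₁' : C) (f₁₁ : X₁' ⟶ X₂) (f₃₁ : X₃ ⟶ X₁'⟦(1:ℤ)⟧),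
      (Triangle.mk f₁₁ f₂ f₃₁ ∈ distTriang C) ∧
      Nonempty (Triangle.mk (biprod.lift f₁ g₁) (biprod.desc f₂ g₂) f₃ ≅
        triangleSum (Triangle.mk f₁₁ f₂ f₃₁)
          (Triangle.mk (𝟙 Y₂) (0 : Y₂ ⟶ (0 : C)) (0 : (0 : C) ⟶ Y₂⟦(1:ℤ)⟧))) := by
  obtain ⟨t, ht⟩ : ∃ t : Y₂ ⟶ X₂, g₂ = t ≫ f₂ := by
    rcases h with rfl | ⟨s, hs⟩
    · exact ⟨0, by simp⟩
    · have h₀ : biprod.lift f₁ g₁ ≫ biprod.desc f₂ g₂ = 0 := comp_distTriang_mor_zero₁₂ _ hT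
      rw [biprod.lift_desc] at h₀
      refine ⟨-(s ≫ f₁), ?_⟩
      have h₁ := s ≫= h₀
      rw [Preadditive.comp_add, reassoc_of% hs, comp_zero] at h₁
      simpa using eq_neg_of_add_eq_zero_right h₁
  subst ht
  obtain ⟨X₁', f₁₁, f₃₁, hT'⟩ := distinguished_cocone_triangle₁ f₂
  refine ⟨X₁', f₁₁, f₃₁, hT', ?_⟩
  let e₂ : X₂ ⊞ Y₂ ≅ X₂ ⊞ Y₂ :=
    { hom := biprod.desc biprod.inl (t ≫ biprod.inl + biprod.inr)
      inv := biprod.desc biprod.inl (-(t ≫ biprod.inl) + biprod.inr)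
      hom_inv_id := by apply biprod.hom_ext' <;> simp
      inv_hom_id := by apply biprod.hom_ext' <;> simp }
  let e₃ : X₃ ≅ X₃ ⊞ (0 : C) :=
    { hom := biprod.inl
      inv := biprod.fst
      inv_hom_id := by
        apply biprod.hom_ext'
        · simp
        · exact (isZero_zero C).eq_of_src _ _ }
  refine nonempty_triangle_iso_of_iso₂₃ hT
    (triangleSum_distinguished hT' (contractible_distinguished Y₂)) e₂ e₃ ?_
  change biprod.desc f₂ (t ≫ f₂) ≫ biprod.inl =
    biprod.desc biprod.inl (t ≫ biprod.inl + biprod.inr) ≫ biprod.map f₂ (0 : Y₂ ⟶ (0 : C))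
  apply biprod.hom_ext' <;> simp
end

section
/- Let X, X', Y, Y' be distinguished triangles in C with X' and Y' contractible. Let φ : X ⊕ X' → Y ⊕ Y' be a morphism of triangles whose components are written in matrix form [[α, β], [γ, δ]] with respect to the biproduct decompositions, and assume that the diagonal entries α = (α₁, α₂, α₃) form a morphism of triangles α : X → Y. Then the mapping cone C(φ) is isomorphic (as a triangle) to the direct sum C(α) ⊕ X'[1] ⊕ Y', where X'[1] denotes the rotation of X' = (X₁', X₂', X₃'; f₁', f₂', f₃'), namely the triangle (X₂', X₃', X₁'⟦1⟧; f₂', f₃', −f₁'⟦1⟧). -/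
open CategoryTheory CategoryTheory.Limits CategoryTheory.Pretriangulated ZeroObject

variable {C : Type*} [Category C] [Preadditive C] [HasZeroObject C] [HasBinaryBiproducts C]
  [HasShift C ℤ] [∀ n : ℤ, (shiftFunctor C n).Additive] [Pretriangulated C]

set_option linter.unusedSectionVars false

/-- An isomorphism between triangles given by explicit morphisms. -/
noncomputable def triangleMkIso {A₁ A₂ A₃ B₁ B₂ B₃ : C} {f₁ : A₁ ⟶ A₂} {f₂ : A₂ ⟶ A₃}
    {f₃ : A₃ ⟶ A₁⟦(1:ℤ)⟧} {g₁ : B₁ ⟶ B₂} {g₂ : B₂ ⟶ B₃} {g₃ : B₃ ⟶ B₁⟦(1:ℤ)⟧}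
    (e₁ : A₁ ≅ B₁) (e₂ : A₂ ≅ B₂) (e₃ : A₃ ≅ B₃)
    (comm₁ : f₁ ≫ e₂.hom = e₁.hom ≫ g₁) (comm₂ : f₂ ≫ e₃.hom = e₂.hom ≫ g₂)
    (comm₃ : f₃ ≫ e₁.hom⟦(1:ℤ)⟧' = e₃.hom ≫ g₃) :
    Triangle.mk f₁ f₂ f₃ ≅ Triangle.mk g₁ g₂ g₃ :=
  Triangle.isoMk _ _ e₁ e₂ e₃ comm₁ comm₂ comm₃

lemma shift_biprod_lift {A B D : C} (f : A ⟶ B) (g : A ⟶ D) :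
    (biprod.lift f g)⟦(1:ℤ)⟧' =
      f⟦(1:ℤ)⟧' ≫ (biprod.inl : B ⟶ B ⊞ D)⟦(1:ℤ)⟧' +
        g⟦(1:ℤ)⟧' ≫ (biprod.inr : D ⟶ B ⊞ D)⟦(1:ℤ)⟧' := by
  rw [biprod.lift_eq, Functor.map_add, Functor.map_comp, Functor.map_comp]

lemma desc_shift_fst {A B A' B' : C} (f : A ⟶ B⟦(1:ℤ)⟧) (f' : A' ⟶ B'⟦(1:ℤ)⟧) :
    biprod.desc (f ≫ (biprod.inl : B ⟶ B ⊞ B')⟦(1:ℤ)⟧')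
        (f' ≫ (biprod.inr : B' ⟶ B ⊞ B')⟦(1:ℤ)⟧') ≫
      (biprod.fst : B ⊞ B' ⟶ B)⟦(1:ℤ)⟧' = biprod.fst ≫ f := by
  ext <;> simp [← Functor.map_comp]

lemma desc_shift_snd {A B A' B' : C} (f : A ⟶ B⟦(1:ℤ)⟧) (f' : A' ⟶ B'⟦(1:ℤ)⟧) :
    biprod.desc (f ≫ (biprod.inl : B ⟶ B ⊞ B')⟦(1:ℤ)⟧')
        (f' ≫ (biprod.inr : B' ⟶ B ⊞ B')⟦(1:ℤ)⟧') ≫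
      (biprod.snd : B ⊞ B' ⟶ B')⟦(1:ℤ)⟧' = biprod.snd ≫ f' := by
  ext <;> simp [← Functor.map_comp]

/-- The shift of a biproduct is the biproduct of the shifts. -/
@[simps]
noncomputable def shiftBiprodIso (A B : C) : (A ⊞ B)⟦(1:ℤ)⟧ ≅ A⟦(1:ℤ)⟧ ⊞ B⟦(1:ℤ)⟧ where
  hom := biprod.lift (biprod.fst⟦(1:ℤ)⟧') (biprod.snd⟦(1:ℤ)⟧')
  inv := biprod.desc (biprod.inl⟦(1:ℤ)⟧') (biprod.inr⟦(1:ℤ)⟧')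
  hom_inv_id := by
    rw [biprod.lift_desc, ← Functor.map_comp, ← Functor.map_comp, ← Functor.map_add, biprod.total,
      CategoryTheory.Functor.map_id]
  inv_hom_id := by ext <;> simp [← Functor.map_comp]

lemma shift_biprod_hom_ext {A B D : C} {f g : D ⟶ (A ⊞ B)⟦(1:ℤ)⟧}
    (h : f ≫ (biprod.fst : A ⊞ B ⟶ A)⟦(1:ℤ)⟧' = g ≫ (biprod.fst : A ⊞ B ⟶ A)⟦(1:ℤ)⟧')
    (h' : f ≫ (biprod.snd : A ⊞ B ⟶ B)⟦(1:ℤ)⟧' = g ≫ (biprod.snd : A ⊞ B ⟶ B)⟦(1:ℤ)⟧') :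
    f = g := by
  rw [← cancel_mono (shiftBiprodIso A B).hom]
  ext <;> simpa

lemma shift_biprod_hom_ext' {A B D : C} {f g : (A ⊞ B)⟦(1:ℤ)⟧ ⟶ D}
    (h : (biprod.inl : A ⟶ A ⊞ B)⟦(1:ℤ)⟧' ≫ f = (biprod.inl : A ⟶ A ⊞ B)⟦(1:ℤ)⟧' ≫ g)
    (h' : (biprod.inr : B ⟶ A ⊞ B)⟦(1:ℤ)⟧' ≫ f = (biprod.inr : B ⟶ A ⊞ B)⟦(1:ℤ)⟧' ≫ g) :
    f = g := by
  rw [← cancel_epi (shiftBiprodIso A B).inv]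
  ext <;> simpa

namespace triangleSum

variable (T T' : Triangle C)

/-- The first inclusion of a direct sum of triangles. -/
noncomputable def inl : T ⟶ triangleSum T T' where
  hom₁ := biprod.inl
  hom₂ := biprod.inl
  hom₃ := biprod.inl
  comm₁ := (biprod.inl_map _ _).symm
  comm₂ := (biprod.inl_map _ _).symm
  comm₃ := (biprod.inl_desc _ _).symm

/-- The second inclusion of a direct sum of triangles. -/
noncomputable def inr : T' ⟶ triangleSum T T' where
  hom₁ := biprod.inr
  hom₂ := biprod.inr
  hom₃ := biprod.inr
  comm₁ := (biprod.inr_map _ _).symm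
  comm₂ := (biprod.inr_map _ _).symm
  comm₃ := (biprod.inr_desc _ _).symm

/-- The first projection of a direct sum of triangles. -/
noncomputable def fst : triangleSum T T' ⟶ T where
  hom₁ := biprod.fst
  hom₂ := biprod.fst
  hom₃ := biprod.fst
  comm₁ := biprod.map_fst _ _
  comm₂ := biprod.map_fst _ _
  comm₃ := desc_shift_fst _ _

/-- The second projection of a direct sum of triangles. -/
noncomputable def snd : triangleSum T T' ⟶ T' where
  hom₁ := biprod.snd
  hom₂ := biprod.snd
  hom₃ := biprod.snd
  comm₁ := biprod.map_snd _ _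
  comm₂ := biprod.map_snd _ _
  comm₃ := desc_shift_snd _ _

lemma fst_inl_add_snd_inr : fst T T' ≫ inl T T' + snd T T' ≫ inr T T' = 𝟙 _ := by
  ext
  · exact biprod.total
  · exact biprod.total
  · exact biprod.total

end triangleSum

/-- A morphism of triangles is null-homotopic if it is `dh + hd` for some `h`. -/
def triangleNullHomotopic {T S : Triangle C} (φ : T ⟶ S) : Prop :=
  ∃ (h₁ : T.obj₂ ⟶ S.obj₁) (h₂ : T.obj₃ ⟶ S.obj₂) (h₃ : T.obj₁⟦(1:ℤ)⟧ ⟶ S.obj₃),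
    φ.hom₂ = h₁ ≫ S.mor₁ + T.mor₂ ≫ h₂ ∧
    φ.hom₃ = h₂ ≫ S.mor₂ + T.mor₃ ≫ h₃ ∧
    φ.hom₁⟦(1:ℤ)⟧' = (T.mor₁ ≫ h₁)⟦(1:ℤ)⟧' + h₃ ≫ S.mor₃

namespace triangleNullHomotopic

variable {S T U : Triangle C}

lemma add {φ ψ : S ⟶ T} (hφ : triangleNullHomotopic φ) (hψ : triangleNullHomotopic ψ) :
    triangleNullHomotopic (φ + ψ) := by
  obtain ⟨h₁, h₂, h₃, e₂, e₃, e₁⟩ := hφ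
  obtain ⟨k₁, k₂, k₃, f₂, f₃, f₁⟩ := hψ
  refine ⟨h₁ + k₁, h₂ + k₂, h₃ + k₃, ?_, ?_, ?_⟩
  · simp only [Triangle.add_hom₂, e₂, f₂, Preadditive.add_comp, Preadditive.comp_add]
    abel
  · simp only [Triangle.add_hom₃, e₃, f₃, Preadditive.add_comp, Preadditive.comp_add]
    abel
  · simp only [Triangle.add_hom₁, Functor.map_add, e₁, f₁, Preadditive.add_comp,
      Preadditive.comp_add]
    abel

lemma comp_left {ψ : T ⟶ U} (hψ : triangleNullHomotopic ψ) (φ : S ⟶ T) :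
    triangleNullHomotopic (φ ≫ ψ) := by
  obtain ⟨h₁, h₂, h₃, e₂, e₃, e₁⟩ := hψ
  refine ⟨φ.hom₂ ≫ h₁, φ.hom₃ ≫ h₂, φ.hom₁⟦(1:ℤ)⟧' ≫ h₃, ?_, ?_, ?_⟩
  · simp [e₂]
  · simp [e₃]
  · rw [TriangleMorphism.comm₁_assoc]
    simp [e₁]

lemma comp_right {φ : S ⟶ T} (hφ : triangleNullHomotopic φ) (ψ : T ⟶ U) :
    triangleNullHomotopic (φ ≫ ψ) := by
  obtain ⟨h₁, h₂, h₃, e₂, e₃, e₁⟩ := hφ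
  refine ⟨h₁ ≫ ψ.hom₁, h₂ ≫ ψ.hom₂, h₃ ≫ ψ.hom₃, ?_, ?_, ?_⟩
  · simp [e₂]
  · simp [e₃]
  · simp [e₁]

end triangleNullHomotopic

lemma triangleContractible.nullHomotopic_id {T : Triangle C} (hT : triangleContractible T) :
    triangleNullHomotopic (𝟙 T) := by
  obtain ⟨h₁, h₂, h₃, e₂, e₃, e₁⟩ := hT
  exact ⟨h₁, h₂, h₃, e₂, e₃, by simpa using e₁⟩

namespace triangleCone

/-- Homotopic morphisms of triangles have isomorphic mapping cones. -/
lemma nonempty_iso_of_nullHomotopic {S T : Triangle C} {φ ψ χ : S ⟶ T}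
    (h : φ = ψ + χ) (hχ : triangleNullHomotopic χ) :
    Nonempty (triangleCone φ ≅ triangleCone ψ) := by
  subst h
  obtain ⟨h₁, h₂, h₃, e₂, e₃, e₁⟩ := hχ
  refine ⟨triangleMkIso (Biprod.unipotentUpper h₁) (Biprod.unipotentUpper h₂)
    (Biprod.unipotentUpper h₃) ?_ ?_ ?_⟩
  · ext <;> simp [Biprod.ofComponents, e₂]
    abel
  · ext <;> simp [Biprod.ofComponents, e₃]
    abel
  · apply biprod.hom_ext'
    · simp [shift_biprod_lift, Biprod.ofComponents, e₁, ← Functor.map_comp]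
      simp [Functor.map_comp]
      abel
    · simp [Biprod.ofComponents, ← Functor.map_comp]

/-- The interchange isomorphism of biproducts. -/
@[simps]
noncomputable def biprodInterchange (A B A' B' : C) :
    (A ⊞ B) ⊞ (A' ⊞ B') ≅ (A ⊞ A') ⊞ (B ⊞ B') where
  hom := biprod.lift (biprod.map biprod.fst biprod.fst) (biprod.map biprod.snd biprod.snd)
  inv := biprod.lift (biprod.map biprod.fst biprod.fst) (biprod.map biprod.snd biprod.snd)

/-- The mapping cone of `α ⊕ 0` is `C(α) ⊕ S'[1] ⊕ T'`. -/
lemma nonempty_iso_of_diagonal {S S' T T' : Triangle C} (φ : triangleSum S S' ⟶ triangleSum T T')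
    (α : S ⟶ T) (h : φ = triangleSum.fst S S' ≫ α ≫ triangleSum.inl T T') :
    Nonempty (triangleCone φ ≅ triangleSum (triangleCone α) (triangleSum S'.rotate T')) := by
  subst h
  refine ⟨triangleMkIso
    (f₁ := biprod.desc
      (biprod.lift (-biprod.map S.mor₂ S'.mor₂) (biprod.fst ≫ α.hom₂ ≫ biprod.inl))
      (biprod.lift 0 (biprod.map T.mor₁ T'.mor₁)))
    (f₂ := biprod.desc
      (biprod.lift (-biprod.desc (S.mor₃ ≫ biprod.inl⟦(1:ℤ)⟧') (S'.mor₃ ≫ biprod.inr⟦(1:ℤ)⟧'))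
        (biprod.fst ≫ α.hom₃ ≫ biprod.inl))
      (biprod.lift 0 (biprod.map T.mor₂ T'.mor₂)))
    (f₃ := biprod.desc
      ((biprod.lift (-biprod.map S.mor₁ S'.mor₁) (biprod.fst ≫ α.hom₁ ≫ biprod.inl))⟦(1:ℤ)⟧')
      (biprod.desc (T.mor₃ ≫ biprod.inl⟦(1:ℤ)⟧') (T'.mor₃ ≫ biprod.inr⟦(1:ℤ)⟧') ≫
        biprod.inr⟦(1:ℤ)⟧'))
    (g₁ := biprod.map
      (biprod.desc (biprod.lift (-S.mor₂) α.hom₂) (biprod.lift 0 T.mor₁))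
      (biprod.map S'.mor₂ T'.mor₁))
    (g₂ := biprod.map
      (biprod.desc (biprod.lift (-S.mor₃) α.hom₃) (biprod.lift 0 T.mor₂))
      (biprod.map S'.mor₃ T'.mor₂))
    (g₃ := biprod.desc
      (biprod.desc ((biprod.lift (-S.mor₁) α.hom₁)⟦(1:ℤ)⟧') (T.mor₃ ≫ biprod.inr⟦(1:ℤ)⟧') ≫
        biprod.inl⟦(1:ℤ)⟧')
      (biprod.desc ((-S'.mor₁⟦(1:ℤ)⟧') ≫ biprod.inl⟦(1:ℤ)⟧') (T'.mor₃ ≫ biprod.inr⟦(1:ℤ)⟧') ≫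
        biprod.inr⟦(1:ℤ)⟧'))
    (biprodInterchange _ _ _ _)
    (biprodInterchange _ _ _ _ ≪≫
      biprod.mapIso (Iso.refl _) (biprod.mapIso (-Iso.refl _) (Iso.refl _)))
    (biprod.mapIso (shiftBiprodIso _ _) (Iso.refl _) ≪≫
      biprodInterchange _ _ _ _) ?_ ?_ ?_⟩
  · ext <;> simp
  · ext <;> simp [← Functor.map_comp]
  · apply biprod.hom_ext'
    · apply shift_biprod_hom_ext' <;> apply shift_biprod_hom_ext <;>
        apply shift_biprod_hom_ext <;> simp [← Functor.map_comp]
    · apply biprod.hom_ext' <;> apply shift_biprod_hom_ext <;>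
        apply shift_biprod_hom_ext <;> simp [← Functor.map_comp]

end triangleCone

/-- Let `X, X', Y, Y'` be distinguished triangles with `X'` and `Y'` contractible, and let
`φ : X ⊕ X' ⟶ Y ⊕ Y'` be a morphism of triangles whose diagonal entries form a morphism of
triangles `α : X ⟶ Y`. Then the mapping cone `C(φ)` is isomorphic to the direct sum
`C(α) ⊕ X'[1] ⊕ Y'`, where `X'[1]` is the rotation of `X'`. -/
theorem stmt8 {X X' Y Y' : Triangle C}
    (hX : X ∈ distTriang C) (hX' : X' ∈ distTriang C)
    (hY : Y ∈ distTriang C) (hY' : Y' ∈ distTriang C)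
    (hcX' : triangleContractible X') (hcY' : triangleContractible Y')
    (φ : triangleSum X X' ⟶ triangleSum Y Y') (α : X ⟶ Y)
    (hdiag₁ : (biprod.inl : X.obj₁ ⟶ X.obj₁ ⊞ X'.obj₁) ≫ φ.hom₁ ≫ biprod.fst = α.hom₁)
    (hdiag₂ : (biprod.inl : X.obj₂ ⟶ X.obj₂ ⊞ X'.obj₂) ≫ φ.hom₂ ≫ biprod.fst = α.hom₂)
    (hdiag₃ : (biprod.inl : X.obj₃ ⟶ X.obj₃ ⊞ X'.obj₃) ≫ φ.hom₃ ≫ biprod.fst = α.hom₃) :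
    Nonempty (triangleCone φ ≅
      triangleSum (triangleCone α) (triangleSum X'.rotate Y')) := by
  let F := triangleSum.fst X X'
  have key : φ = F ≫ α ≫ triangleSum.inl Y Y' +
      ((F ≫ triangleSum.inl X X' ≫ φ ≫ triangleSum.snd Y Y') ≫ 𝟙 Y' ≫ triangleSum.inr Y Y' +
        triangleSum.snd X X' ≫ 𝟙 X' ≫ triangleSum.inr X X' ≫ φ) := by
    have hα : α = triangleSum.inl X X' ≫ φ ≫ triangleSum.fst Y Y' := by
      ext
      · exact hdiag₁.symm
      · exact hdiag₂.symm
      · exact hdiag₃.symm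
    have h := triangleSum.fst_inl_add_snd_inr X X' =≫ φ
    have h' := F ≫= triangleSum.inl X X' ≫= φ ≫= triangleSum.fst_inl_add_snd_inr Y Y'
    simp only [Preadditive.add_comp, Preadditive.comp_add, Category.assoc, Category.id_comp,
      Category.comp_id] at h h'
    simp only [hα, Category.assoc, Category.id_comp, ← add_assoc]
    rw [h', h]
  obtain ⟨e⟩ := triangleCone.nonempty_iso_of_nullHomotopic key
    (((hcY'.nullHomotopic_id.comp_right _).comp_left _).add
      ((hcX'.nullHomotopic_id.comp_right _).comp_left _))
  obtain ⟨e'⟩ := triangleCone.nonempty_iso_of_diagonal _ α rfl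
  exact ⟨e ≪≫ e'⟩
end
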